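/- Let p be an odd prime, α ∈ ℤ_p, and z ∈ ℤ_p^× with z − 1 ∈ ℤ_p^×. Set λ = λ_p^{(2)}(α). Then ∑_{k=0}^{p−1} (α)_k²/(k!)² · z^k − z^{1−λ} · ∑_{k=0}^{p−1} (α)_k²/(k!)² · z^{−k} ≡ (1−z)^{1−λ} · ∑_{k=0}^{p−1} (α)_k(1−α)_k/(k!)² · (z/(z−1))^k (mod p²). (This is the p-adic analogue of the Pfaff transformation ₂F₁[α,α;1|z] = (1−z)^{−α} ₂F₁[α,1−α;1|z/(z−1)].) -/

import Mathlib

open scoped BigOperators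

/-- The Pochhammer symbol `(x)_k = x(x+1)⋯(x+k-1)` in `ℚ_[p]`. -/
noncomputable def poch (p : ℕ) [Fact p.Prime] (x : ℚ_[p]) (k : ℕ) : ℚ_[p] :=
  (ascPochhammer ℚ_[p] k).eval x

/-- The least non-negative residue `⟨α⟩_p ∈ {0,…,p-1}` of `α ∈ ℤ_[p]` modulo `p`. -/
noncomputable def res (p : ℕ) [Fact p.Prime] (α : ℤ_[p]) : ℕ :=
  (PadicInt.toZMod α).val

/-- The least non-negative residue `⟨α⟩_{p²} ∈ {0,…,p²-1}` of `α ∈ ℤ_[p]` modulo `p²`. -/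
noncomputable def res2 (p : ℕ) [Fact p.Prime] (α : ℤ_[p]) : ℕ :=
  (PadicInt.toZModPow 2 α).val

/-- `λ_p^{(2)}(α) = ((⟨−α⟩_p − ⟨−α⟩_{p²})/p)·(p−1) − ⟨−α⟩_p`, an integer congruent mod `p²`
to the exponent `λ_p(α)` of the paper on units. -/
noncomputable def lam2 (p : ℕ) [Fact p.Prime] (α : ℤ_[p]) : ℤ :=
  (((res p (-α) : ℤ) - (res2 p (-α) : ℤ)) / (p : ℤ)) * ((p : ℤ) - 1) - (res p (-α) : ℤ)

open Polynomial in
theorem descPochhammer_eval_add_one {R : Type*} [CommRing R] (n : ℕ) (x : R) :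
    (descPochhammer R (n + 1)).eval (x + 1) =
      (descPochhammer R (n + 1)).eval x + (n + 1) * (descPochhammer R n).eval x := by
  have h := congrArg (eval (x + 1)) (descPochhammer_succ_comp_X_sub_one (R := R) n)
  simp [eval_comp] at h
  linear_combination -h

theorem descPochhammer_eval_reflect {R : Type*} [CommRing R] (n : ℕ) (x : R) :
    (descPochhammer R n).eval (n - 1 - x) = (-1) ^ n * (descPochhammer R n).eval x := by
  rw [descPochhammer_eval_eq_ascPochhammer, ← ascPochhammer_eval_neg_eq_descPochhammer]
  congr 1
  ring

open Polynomial in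
theorem descPochhammer_eval_add {R : Type*} [CommRing R] (n : ℕ) (x y : R) :
    (descPochhammer R n).eval (x + y) = ∑ i ∈ Finset.range (n + 1),
      (n.choose i : R) * ((descPochhammer R i).eval x * (descPochhammer R (n - i)).eval y) := by
  have h (k : ℕ) (t : R) : (descPochhammer ℤ k).smeval t = (descPochhammer R k).eval t := by
    rw [← descPochhammer_map (algebraMap ℤ R), eval_map_algebraMap, aeval_eq_smeval]
  have := Ring.descPochhammer_smeval_add n (Commute.all x y)
  rw [Finset.Nat.sum_antidiagonal_eq_sum_range_succ_mk] at this
  simpa [h, nsmul_eq_mul] using this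

open Polynomial in
theorem descPochhammer_eval_sq {R : Type*} [CommRing R] (m : ℕ) (x : R) :
    (descPochhammer R m).eval x ^ 2 = ∑ i ∈ Finset.range (m + 1),
      (m.choose i : R) * (m.descFactorial (m - i) * (descPochhammer R (m + i)).eval x) := by
  have h := descPochhammer_eval_add m (x - m) (m : R)
  rw [sub_add_cancel] at h
  rw [sq]
  nth_rw 2 [h]
  rw [Finset.mul_sum]
  refine Finset.sum_congr rfl fun i _ => ?_
  rw [← descPochhammer_mul, descPochhammer_eval_eq_descFactorial]
  simp [eval_comp]
  ring

theorem eq_sum_add_of_sub_mul_eq {R : Type*} [CommRing R] {g f : R → R} {z : R}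
    (h : ∀ x, g x - z * g (x + 1) = f x) (x : R) (n : ℕ) :
    g x = ∑ j ∈ Finset.range n, f (x + j) * z ^ j + z ^ n * g (x + n) := by
  induction n with
  | zero => simp
  | succ n ih =>
    rw [Finset.sum_range_succ, ← h (x + n), ih]
    push_cast
    rw [← add_assoc x]
    ring

open Polynomial in
theorem exists_polynomial_descPochhammer {R : Type*} [CommRing R] {z y : R}
    (hy : (1 - z) * y = 1) (n : ℕ) :
    ∃ g : R[X], (∀ x, g.eval x - z * g.eval (x + 1) = (descPochhammer R n).eval x) ∧
      g.eval 0 = n.factorial * z ^ n * y ^ (n + 1) := by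
  induction n with
  | zero => exact ⟨C y, fun x => by simp; linear_combination hy, by simp⟩
  | succ n ih =>
    obtain ⟨g, hg, hg0⟩ := ih
    refine ⟨C y * (descPochhammer R (n + 1) + C (z * (n + 1)) * g), fun x => ?_, ?_⟩
    · simp only [eval_mul, eval_C, eval_add, descPochhammer_eval_add_one]
      linear_combination y * z * (n + 1) * hg x + (descPochhammer R (n + 1)).eval x * hy
    · simp only [eval_mul, eval_C, eval_add, hg0,
        descPochhammer_ne_zero_eval_zero (R := R) n.succ_ne_zero, Nat.factorial_succ]
      push_cast
      ring

open Polynomial in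
theorem exists_polynomial_descPochhammer_sq {R : Type*} [CommRing R] {z y c : R}
    (hy : (1 - z) * y = 1) (m : ℕ) (hc : c * m.factorial = 1) :
    ∃ g : R[X], (∀ x, g.eval x - z * g.eval (x + 1) = (c * (descPochhammer R m).eval x) ^ 2) ∧
      g.eval 0 = z ^ m * y ^ (m + 1) * ∑ i ∈ Finset.range (m + 1),
        (m.choose i * (m + i).choose i : R) * (z * y) ^ i := by
  choose G hG hG0 using fun n => exists_polynomial_descPochhammer (R := R) hy n
  refine ⟨∑ i ∈ Finset.range (m + 1),
    C (c ^ 2 * (m.choose i * m.descFactorial (m - i))) * G (m + i), fun x => ?_, ?_⟩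
  · rw [mul_pow, descPochhammer_eval_sq]
    simp only [eval_finsetSum, eval_mul, eval_C, Finset.mul_sum, ← Finset.sum_sub_distrib, ← hG]
    exact Finset.sum_congr rfl fun i _ => by ring
  · simp only [eval_finsetSum, eval_mul, eval_C, Finset.mul_sum, hG0]
    refine Finset.sum_congr rfl fun i hi => ?_
    have hi' : i ≤ m := Nat.lt_succ_iff.mp (Finset.mem_range.mp hi)
    have h1 : (i.factorial : R) * m.descFactorial (m - i) = m.factorial := by
      have := Nat.factorial_mul_descFactorial (Nat.sub_le m i)
      rw [Nat.sub_sub_self hi'] at this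
      rw [← Nat.cast_mul, this]
    have h2 : ((m + i).factorial : R) = (m + i).choose i * m.factorial * i.factorial := by
      have := Nat.add_choose_mul_factorial_mul_factorial m i
      rw [← this]
      push_cast
      ring
    have h3 : c ^ 2 * (m.factorial * m.factorial : R) = 1 := by
      linear_combination (c * m.factorial + 1) * hc
    rw [h2]
    linear_combination (c ^ 2 * m.choose i * (m + i).choose i * m.factorial * z ^ (m + i) *
      y ^ (m + i + 1)) * h1 + (m.choose i * (m + i).choose i * z ^ (m + i) *
      y ^ (m + i + 1)) * h3

theorem sum_choose_sq_mul_pow {R : Type*} [CommRing R] (a : ℕ) (z s : R) :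
    ∑ k ∈ Finset.range (a + 1), (a.choose k : R) ^ 2 * z ^ k * (z + s) ^ (a - k) =
      ∑ i ∈ Finset.range (a + 1), (a.choose i * (a + i).choose i : R) * z ^ i * s ^ (a - i) := by
  have h := Finset.sum_range_diag_flip (a + 1) fun k j =>
    (a.choose k : R) ^ 2 * (a - k).choose j * z ^ (k + j) * s ^ (a - k - j)
  calc _ = _ := Finset.sum_congr rfl fun k hk => ?_
    _ = _ := h.symm
    _ = _ := Finset.sum_congr rfl fun i hi => ?_
  · have hk' := Finset.mem_range.mp hk
    rw [add_pow, Finset.mul_sum, show a - k + 1 = a + 1 - k by omega]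
    exact Finset.sum_congr rfl fun j _ => by ring
  · have hi' := Finset.mem_range.mp hi
    rw [Nat.add_choose_eq, Finset.Nat.sum_antidiagonal_eq_sum_range_succ_mk]
    push_cast
    simp only [Finset.mul_sum, Finset.sum_mul]
    refine Finset.sum_congr rfl fun k hk => ?_
    have hk' := Finset.mem_range.mp hk
    have hm := Nat.choose_mul (n := a) (k := i) (s := k) (by omega)
    rw [show k + (i - k) = i by omega, show a - k - (i - k) = a - i by omega,
      Nat.choose_symm (by omega : k ≤ i)]
    have hm' : (a.choose i : R) * i.choose k = a.choose k * (a - k).choose (i - k) := by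
      rw [← Nat.cast_mul, hm, Nat.cast_mul]
    linear_combination (-(a.choose k : R)  * z ^ i * s ^ (a - i)) * hm'

theorem sum_range_eq_of_le_of_eq_zero {R : Type*} [AddCommMonoid R] {f : ℕ → R} {m n : ℕ}
    (hmn : m ≤ n) (hf : ∀ k, m ≤ k → f k = 0) :
    ∑ k ∈ Finset.range n, f k = ∑ k ∈ Finset.range m, f k := by
  refine (Finset.sum_subset (Finset.range_mono hmn) fun k _ hk => hf k ?_).symm
  simpa using hk

/-- The Pfaff transformation for `α = -a` with `a` a natural number, where it is exact. -/
theorem pfaff_of_eq_neg_natCast {R : Type*} [CommRing R] {z w y : R} (hw : z * w = 1)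
    (hy : (1 - z) * y = 1) {a p : ℕ} (ha : a < p) :
    ∑ k ∈ Finset.range p, (a.choose k : R) ^ 2 * z ^ k
      - z ^ (1 + a) * ∑ k ∈ Finset.range p, (a.choose k : R) ^ 2 * w ^ k
      = (1 - z) ^ (1 + a) *
        ∑ k ∈ Finset.range p, (a.choose k * (a + k).choose k : R) * (z * y) ^ k := by
  have h0 : ∀ k, a + 1 ≤ k → (a.choose k : R) = 0 := fun k hk => by
    rw [Nat.choose_eq_zero_of_lt hk, Nat.cast_zero]
  rw [sum_range_eq_of_le_of_eq_zero ha fun k hk => by rw [h0 k hk]; ring,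
    sum_range_eq_of_le_of_eq_zero ha fun k hk => by rw [h0 k hk]; ring,
    sum_range_eq_of_le_of_eq_zero ha fun k hk => by rw [h0 k hk]; ring]
  have h1 : z ^ a * ∑ k ∈ Finset.range (a + 1), (a.choose k : R) ^ 2 * w ^ k =
      ∑ k ∈ Finset.range (a + 1), (a.choose k : R) ^ 2 * z ^ k := by
    rw [← Finset.sum_flip, Finset.mul_sum]
    refine Finset.sum_congr rfl fun k hk => ?_
    have hk' : k ≤ a := Nat.lt_succ_iff.mp (Finset.mem_range.mp hk)
    have h2 : z ^ (a - k) * w ^ (a - k) = 1 := by rw [← mul_pow, hw, one_pow]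
    rw [Nat.choose_symm hk', ← pow_mul_pow_sub z hk']
    linear_combination (a.choose k : R) ^ 2 * z ^ k * h2
  have h3 : (1 - z) ^ a * ∑ k ∈ Finset.range (a + 1),
      (a.choose k * (a + k).choose k : R) * (z * y) ^ k =
      ∑ k ∈ Finset.range (a + 1), (a.choose k : R) ^ 2 * z ^ k := by
    have h4 := sum_choose_sq_mul_pow a z (1 - z)
    simp only [add_sub_cancel, one_pow, mul_one] at h4
    rw [h4, Finset.mul_sum]
    refine Finset.sum_congr rfl fun k hk => ?_
    have hk' : k ≤ a := Nat.lt_succ_iff.mp (Finset.mem_range.mp hk)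
    have h2 : (1 - z) ^ k * y ^ k = 1 := by rw [← mul_pow, hy, one_pow]
    rw [mul_pow, ← pow_mul_pow_sub (1 - z) hk']
    linear_combination (a.choose k * (a + k).choose k : R) * z ^ k * (1 - z) ^ (a - k) * h2
  linear_combination (1 - z) * (-h3) - z * h1

/-- The Pfaff transformation for `α = m + 1` with `m < p` a natural number. -/
theorem pfaff_of_eq_natCast_add_one {R : Type*} [CommRing R] {z w y c : R} (hw : z * w = 1)
    (hy : (1 - z) * y = 1) {m p : ℕ} (hm : m < p) (hc : c * m.factorial = 1)
    (hz : (p : R) ∣ z ^ (p - 1) - 1) :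
    (p : R) ^ 2 ∣ ∑ k ∈ Finset.range p, ((m + k).choose k : R) ^ 2 * z ^ k
      - z * w ^ m * ∑ k ∈ Finset.range p, ((m + k).choose k : R) ^ 2 * w ^ k
      - (1 - z) * y ^ m *
        ∑ k ∈ Finset.range p, (m.choose k * (m + k).choose k : R) * (z * y) ^ k := by
  obtain ⟨g, hg, hg0⟩ := exists_polynomial_descPochhammer_sq hy m hc
  rw [sum_range_eq_of_le_of_eq_zero (f := fun k => (m.choose k * (m + k).choose k : R) *
    (z * y) ^ k) hm fun k hk => by simp [Nat.choose_eq_zero_of_lt hk]]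
  set Q := ∑ k ∈ Finset.range (m + 1), (m.choose k * (m + k).choose k : R) * (z * y) ^ k
  have hval (k : ℕ) : (c * (descPochhammer R m).eval ((m : R) + k)) ^ 2 =
      ((m + k).choose k : R) ^ 2 := by
    rw [← Nat.cast_add, descPochhammer_eval_eq_descFactorial,
      Nat.descFactorial_eq_factorial_mul_choose, Nat.choose_symm_add]
    push_cast
    rw [← mul_assoc, hc, one_mul]
  have hD (j : ℕ) (hj : j < m) : (descPochhammer R m).eval (j : R) = 0 := by
    rw [descPochhammer_eval_eq_descFactorial, Nat.descFactorial_of_lt hj, Nat.cast_zero]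
  have h1 : g.eval 0 = z ^ m * g.eval (m : R) := by
    have := eq_sum_add_of_sub_mul_eq hg 0 m
    rw [zero_add, Finset.sum_eq_zero, zero_add] at this
    · exact this
    · intro j hj
      rw [zero_add, hD j (Finset.mem_range.mp hj)]
      ring
  have h2 := eq_sum_add_of_sub_mul_eq hg m p
  simp only [hval] at h2
  have h3 : (p : R) ^ 2 ∣ g.eval (p : R) - z ^ m * g.eval ((m : R) + p) := by
    have := eq_sum_add_of_sub_mul_eq hg p m
    rw [this, add_comm (p : R) m, add_sub_cancel_right]
    refine Finset.dvd_sum fun j hj => Dvd.dvd.mul_right (pow_dvd_pow_of_dvd ?_ 2) _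
    refine Dvd.dvd.mul_left ?_ _
    have := Polynomial.sub_dvd_eval_sub ((p : R) + j) j (descPochhammer R m)
    rwa [hD j (Finset.mem_range.mp hj), sub_zero, add_sub_cancel_right] at this
  have h4 := eq_sum_add_of_sub_mul_eq (g := fun x : R => -z * g.eval (m - x))
    (f := fun x : R => (c * (descPochhammer R m).eval x) ^ 2) (z := w) (fun x => by
      have h := hg (m - 1 - x)
      rw [descPochhammer_eval_reflect, show (m : R) - 1 - x + 1 = m - x by ring] at h
      have h5 : ((-1 : R) ^ m) ^ 2 = 1 := by rw [← pow_mul, mul_comm, pow_mul]; simp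
      rw [show (m : R) - (x + 1) = m - 1 - x by ring]
      linear_combination h + (c * (descPochhammer R m).eval x) ^ 2 * h5 +
        g.eval (m - 1 - x) * hw) m p
  simp only [hval, sub_self, sub_add_cancel_left] at h4
  obtain ⟨k1, hk1⟩ := Polynomial.binomExpansion g 0 (p : R)
  obtain ⟨k2, hk2⟩ := Polynomial.binomExpansion g 0 (-(p : R))
  rw [zero_add] at hk1 hk2
  obtain ⟨k3, hk3⟩ := h3
  obtain ⟨e, he⟩ := hz
  obtain ⟨q, rfl⟩ : ∃ q, p = q + 1 := ⟨p - 1, by omega⟩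
  rw [Nat.add_sub_cancel] at he
  have hq : z ^ q * w ^ q = 1 := by rw [← mul_pow, hw, one_pow]
  have hwm : z ^ m * w ^ m = 1 := by rw [← mul_pow, hw, one_pow]
  set T := ∑ k ∈ Finset.range (q + 1), ((m + k).choose k : R) ^ 2 * z ^ k
  set U := ∑ k ∈ Finset.range (q + 1), ((m + k).choose k : R) ^ 2 * w ^ k
  set P : R := ((q + 1 : ℕ) : R)
  set G0 := g.eval 0
  set d := (Polynomial.derivative g).eval 0
  set q' := w ^ q
  have hzq : z ^ q = 1 + P * e := by linear_combination he
  have hq1 : (1 + P * e) * q' = 1 := by rw [← hzq, hq]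
  have key : z ^ m * (T - z * w ^ m * U - (1 - z) * y ^ m * Q) =
      z * (2 * G0 - (1 + P * e) * g.eval P - q' * g.eval (-P)) + P ^ 2 * (k3 * z ^ (q + 1)) := by
    have hU : U = -z * G0 + z * w * q' * g.eval (-P) := by
      rw [pow_succ] at h4
      linear_combination -h4
    have e1 : z ^ m * T = G0 - z * (1 + P * e) * (g.eval P - P ^ 2 * k3) := by
      have : z ^ (q + 1) = z * (1 + P * e) := by rw [pow_succ, hzq]; ring
      rw [← this]
      linear_combination -z ^ m * h2 - h1 + z ^ (q + 1) * hk3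
    have e2 : z ^ m * ((1 - z) * y ^ m * Q) = (1 - z) ^ 2 * G0 := by
      rw [hg0]
      linear_combination -(1 - z) * z ^ m * y ^ m * Q * hy
    have : z ^ (q + 1) = z * (1 + P * e) := by rw [pow_succ, hzq]; ring
    rw [this]
    linear_combination e1 - e2 - z * U * hwm - z * hU - z * q' * g.eval (-P) * hw
  have key2 : 2 * G0 - (1 + P * e) * g.eval P - q' * g.eval (-P) =
      P ^ 2 * (-e ^ 2 * q' * G0 - e * (1 + q') * d - (1 + P * e) * k1 - q' * k2) := by
    rw [hk1, hk2]
    linear_combination (-(1 - P * e) * G0 + P * d) * hq1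
  have : T - z * w ^ m * U - (1 - z) * y ^ m * Q =
      w ^ m * (z ^ m * (T - z * w ^ m * U - (1 - z) * y ^ m * Q)) := by
    rw [← mul_assoc, mul_comm (w ^ m), hwm, one_mul]
  rw [this, key, key2]
  exact Dvd.dvd.mul_left (dvd_add (Dvd.dvd.mul_left (dvd_mul_right _ _) _) (dvd_mul_right _ _)) _

/-- `(u, v, x)` are, modulo `P²`, the values at `0`, `-1` and `τ` of `t ↦ c + P t d`. -/
def IsAffineTriple {R : Type*} [CommRing R] (P τ u v x : R) : Prop :=
  P ∣ u - v ∧ P ^ 2 ∣ x - u - τ * (u - v)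

namespace IsAffineTriple

variable {R : Type*} [CommRing R] {P τ u v x u' v' x' : R}

theorem const (c : R) : IsAffineTriple P τ c c c := by simp [IsAffineTriple]

theorem add (h : IsAffineTriple P τ u v x) (h' : IsAffineTriple P τ u' v' x') :
    IsAffineTriple P τ (u + u') (v + v') (x + x') := by
  obtain ⟨⟨a, ha⟩, b, hb⟩ := h
  obtain ⟨⟨a', ha'⟩, b', hb'⟩ := h'
  exact ⟨⟨a + a', by linear_combination ha + ha'⟩, b + b', by linear_combination hb + hb'⟩

theorem mul (h : IsAffineTriple P τ u v x) (h' : IsAffineTriple P τ u' v' x') :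
    IsAffineTriple P τ (u * u') (v * v') (x * x') := by
  obtain ⟨⟨a, ha⟩, b, hb⟩ := h
  obtain ⟨⟨a', ha'⟩, b', hb'⟩ := h'
  obtain rfl : v = u - P * a := by linear_combination -ha
  obtain rfl : v' = u' - P * a' := by linear_combination -ha'
  obtain rfl : x = u + τ * (P * a) + P ^ 2 * b := by linear_combination hb
  obtain rfl : x' = u' + τ * (P * a') + P ^ 2 * b' := by linear_combination hb'
  exact ⟨⟨u * a' + a * u' - P * a * a', by ring⟩,
    u * b' + u' * b + τ ^ 2 * a * a' + τ * P * (a * b' + a' * b) + P ^ 2 * b * b' + τ * a * a',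
    by ring⟩

theorem sub (h : IsAffineTriple P τ u v x) (h' : IsAffineTriple P τ u' v' x') :
    IsAffineTriple P τ (u - u') (v - v') (x - x') := by
  simpa [sub_eq_add_neg] using h.add ((const (-1)).mul h')

theorem sum {ι : Type*} (s : Finset ι) {f f' f'' : ι → R}
    (h : ∀ i ∈ s, IsAffineTriple P τ (f i) (f' i) (f'' i)) :
    IsAffineTriple P τ (∑ i ∈ s, f i) (∑ i ∈ s, f' i) (∑ i ∈ s, f'' i) := by
  induction s using Finset.cons_induction with
  | empty => simpa using const 0
  | cons a s ha ih =>
    simp only [Finset.sum_cons]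
    exact (h a (by simp)).add (ih fun i hi => h i (by simp [hi]))

theorem ascPochhammer_eval (h : IsAffineTriple P τ u v x) (k : ℕ) :
    IsAffineTriple P τ ((ascPochhammer R k).eval u) ((ascPochhammer R k).eval v)
      ((ascPochhammer R k).eval x) := by
  induction k with
  | zero => simpa using const 1
  | succ k ih =>
    simp only [ascPochhammer_succ_eval]
    exact ih.mul (h.add (const _))

theorem one_inv_pow {y w s : R} (hyw : y * w = 1) (hy : P ∣ y - 1) {t : ℕ}
    (hτ : τ = t + P * s) : IsAffineTriple P τ 1 w (y ^ t) := by
  obtain ⟨e, he⟩ := hy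
  obtain rfl : y = 1 + P * e := by linear_combination he
  have hw : 1 - w = P * (e * w) := by linear_combination -hyw
  refine ⟨⟨_, hw⟩, ?_⟩
  have ht : ∃ d, (1 + P * e) ^ t = 1 + t * (P * e) + P ^ 2 * d := by
    clear hτ
    induction t with
    | zero => exact ⟨0, by simp⟩
    | succ t ih =>
      obtain ⟨d, hd⟩ := ih
      exact ⟨t * e ^ 2 + d * (1 + P * e), by rw [pow_succ, hd]; push_cast; ring⟩
  obtain ⟨d, hd⟩ := ht
  refine ⟨d + t * e ^ 2 * w - s * e * w, ?_⟩
  rw [hd, hw, hτ]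
  linear_combination (-(t * P * e)) * hyw

theorem dvd_of_eq_zero (h : IsAffineTriple P τ u v x) (hu : u = 0) (hv : P ^ 2 ∣ v) :
    P ^ 2 ∣ x := by
  have h2 := h.2
  rw [hu, zero_sub, sub_zero, mul_neg, sub_neg_eq_add] at h2
  exact (dvd_add_left (Dvd.dvd.mul_left hv τ)).mp h2

end IsAffineTriple

/-- Integral form of the congruence, over any commutative ring in which the `k!` with `k < p` are
invertible: `c k = 1 / k!`, `w = 1 / z`, `y = 1 / (1 - z)`. -/
theorem pfaff_sq_dvd {R : Type*} [CommRing R] {z w y s α : R} {c : ℕ → R} {p a t : ℕ}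
    (hw : z * w = 1) (hy : (1 - z) * y = 1) (ha : a < p)
    (hc : ∀ k < p, c k * k.factorial = 1) (hz : (p : R) ∣ z ^ (p - 1) - 1)
    (hz1 : (p : R) ∣ (1 - z) ^ (p - 1) - 1) (hα : α = -(a + p * (t + p * s))) :
    (p : R) ^ 2 ∣
      ∑ k ∈ Finset.range p, (c k * (ascPochhammer R k).eval α) ^ 2 * z ^ k
      - z ^ (1 + a + (p - 1) * t) *
        ∑ k ∈ Finset.range p, (c k * (ascPochhammer R k).eval α) ^ 2 * w ^ k
      - (1 - z) ^ (1 + a + (p - 1) * t) *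
        ∑ k ∈ Finset.range p, c k * (ascPochhammer R k).eval α *
          (c k * (ascPochhammer R k).eval (1 - α)) * (-(z * y)) ^ k := by
  obtain ⟨m, rfl⟩ : ∃ m, p = a + m + 1 := ⟨p - 1 - a, by omega⟩
  set P : R := ((a + m + 1 : ℕ) : R) with hP
  have hPe : P = a + m + 1 := by rw [hP]; push_cast; ring
  rw [Nat.add_sub_cancel] at *
  have hα' : IsAffineTriple P (t + P * s) (-(a : R)) (m + 1) α :=
    ⟨⟨-1, by rw [hPe]; ring⟩, 0, by rw [hα, hPe]; ring⟩
  have hα1 : IsAffineTriple P (t + P * s) (1 - -(a : R)) (1 - (m + 1)) (1 - α) :=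
    (IsAffineTriple.const 1).sub hα'
  have hpow {x v : R} (hx : x * v = 1) (hxp : P ∣ x ^ (a + m) - 1) :
      IsAffineTriple P (t + P * s) (x ^ (1 + a)) (x * v ^ m) (x ^ (1 + a + (a + m) * t)) := by
    have h := (IsAffineTriple.const (x ^ (1 + a))).mul (IsAffineTriple.one_inv_pow
      (y := x ^ (a + m)) (w := v ^ (a + m)) (by rw [← mul_pow, hx, one_pow]) hxp
      (t := t) (s := s) rfl)
    have hxa : x ^ a * v ^ a = 1 := by rw [← mul_pow, hx, one_pow]
    rw [mul_one, ← pow_mul, ← pow_add] at h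
    rwa [show x ^ (1 + a) * v ^ (a + m) = x * v ^ m by
      linear_combination x * v ^ m * hxa] at h
  have hck (k : ℕ) := (IsAffineTriple.const (c k)).mul (hα'.ascPochhammer_eval k)
  have hck1 (k : ℕ) := (IsAffineTriple.const (c k)).mul (hα1.ascPochhammer_eval k)
  have hsq (x : R) := IsAffineTriple.sum (Finset.range (a + m + 1)) fun k _ =>
    ((hck k).mul (hck k)).mul (IsAffineTriple.const (x ^ k))
  have hQ := IsAffineTriple.sum (Finset.range (a + m + 1)) fun k _ =>
    ((hck k).mul (hck1 k)).mul (IsAffineTriple.const ((-(z * y)) ^ k))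
  have hF := ((hsq z).sub ((hpow hw hz).mul (hsq w))).sub ((hpow hy hz1).mul hQ)
  simp only [← sq] at hF
  have hneg (b k : ℕ) (hk : k ∈ Finset.range (a + m + 1)) :
      c k * (ascPochhammer R k).eval (-(b : R)) = (-1) ^ k * b.choose k := by
    rw [ascPochhammer_eval_neg_eq_descPochhammer, descPochhammer_eval_eq_descFactorial,
      Nat.descFactorial_eq_factorial_mul_choose]
    push_cast
    linear_combination (-1) ^ k * b.choose k * hc k (Finset.mem_range.mp hk)
  have hpos (b k : ℕ) (hk : k ∈ Finset.range (a + m + 1)) :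
      c k * (ascPochhammer R k).eval (b + 1 : R) = (b + k).choose k := by
    rw [← Nat.cast_add_one, ascPochhammer_nat_eq_natCast_ascFactorial,
      Nat.ascFactorial_eq_factorial_mul_choose]
    push_cast
    linear_combination (b + k).choose k * hc k (Finset.mem_range.mp hk)
  have hone (k : ℕ) : ((-1 : R) ^ k) ^ 2 = 1 := by rw [← pow_mul, mul_comm, pow_mul]; simp
  refine hF.dvd_of_eq_zero ?_ ?_
  · have h := pfaff_of_eq_neg_natCast hw hy ha
    rw [← sub_eq_zero] at h
    rw [← h]
    congr! 2
    · refine Finset.sum_congr rfl fun k hk => ?_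
      rw [hneg a k hk, mul_pow, hone, one_mul]
    · congr 1
      refine Finset.sum_congr rfl fun k hk => ?_
      rw [hneg a k hk, mul_pow, hone, one_mul]
    · refine Finset.sum_congr rfl fun k hk => ?_
      rw [hneg a k hk, show (1 : R) - -(a : R) = a + 1 by ring, hpos a k hk, neg_pow]
      linear_combination (a.choose k * (a + k).choose k * (z * y) ^ k : R) * hone k
  · have h := pfaff_of_eq_natCast_add_one hw hy (m := m) (p := a + m + 1) (by omega)
      (hc m (by omega)) (by rwa [Nat.add_sub_cancel])
    convert h using 2
    · congr 1
      · refine Finset.sum_congr rfl fun k hk => ?_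
        rw [hpos m k hk]
      · congr 1
        refine Finset.sum_congr rfl fun k hk => ?_
        rw [hpos m k hk]
    · congr 1
      refine Finset.sum_congr rfl fun k hk => ?_
      rw [hpos m k hk, show (1 : R) - (m + 1) = -(m : R) by ring, hneg m k hk, neg_pow]
      linear_combination (m.choose k * (m + k).choose k * (z * y) ^ k : R) * hone k

theorem PadicInt.natCast_dvd_pow_sub_one {p : ℕ} [Fact p.Prime] {x : ℤ_[p]} (hx : IsUnit x) :
    (p : ℤ_[p]) ∣ x ^ (p - 1) - 1 := by
  rw [← Ideal.mem_span_singleton, ← PadicInt.maximalIdeal_eq_span_p, ← PadicInt.ker_toZMod,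
    RingHom.mem_ker, map_sub, map_pow, map_one,
    ZMod.pow_card_sub_one_eq_one (hx.map PadicInt.toZMod).ne_zero, sub_self]

theorem PadicInt.exists_mul_factorial_eq_one {p : ℕ} [hp : Fact p.Prime] {k : ℕ} (hk : k < p) :
    ∃ c : ℤ_[p], c * k.factorial = 1 := by
  have h : IsUnit ((k.factorial : ℕ) : ℤ_[p]) := by
    rw [PadicInt.isUnit_iff, PadicInt.norm_natCast_eq_one_iff]
    exact hp.out.coprime_factorial_of_lt hk
  exact h.exists_left_inv

theorem exists_lam2_eq (p : ℕ) [hp : Fact p.Prime] (α : ℤ_[p]) :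
    ∃ (a t : ℕ) (s : ℤ_[p]), a < p ∧ α = -(a + p * (t + p * s)) ∧
      1 - lam2 p α = ((1 + a + (p - 1) * t : ℕ) : ℤ) := by
  have : NeZero (p ^ 2) := ⟨pow_ne_zero 2 hp.out.ne_zero⟩
  have h1 : (p : ℤ_[p]) ∣ -α - (res p (-α) : ℤ_[p]) := by
    rw [← Ideal.mem_span_singleton, ← PadicInt.maximalIdeal_eq_span_p, ← PadicInt.ker_toZMod,
      RingHom.mem_ker, map_sub, map_natCast, res, ZMod.natCast_zmod_val, sub_self]
  have h2 : (p : ℤ_[p]) ^ 2 ∣ -α - (res2 p (-α) : ℤ_[p]) := by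
    rw [← Ideal.mem_span_singleton, ← PadicInt.ker_toZModPow,
      RingHom.mem_ker, map_sub, map_natCast, res2, ZMod.natCast_zmod_val, sub_self]
  have ha : res p (-α) < p := ZMod.val_lt _
  have hmod : res2 p (-α) % p = res p (-α) := by
    have h3 : (p : ℤ_[p]) ∣ ((res2 p (-α) : ℕ) : ℤ_[p]) - (res p (-α) : ℕ) := by
      have := dvd_sub h1 ((dvd_pow_self _ two_ne_zero).trans h2)
      rwa [sub_sub_sub_cancel_left] at this
    have h4 : (p : ℤ) ∣ (res2 p (-α) : ℤ) - (res p (-α) : ℤ) := by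
      rw [← PadicInt.norm_int_lt_one_iff_dvd, PadicInt.norm_lt_one_iff_dvd]
      exact_mod_cast h3
    rw [← Nat.mod_eq_of_lt ha]
    exact ((Nat.modEq_iff_dvd).mpr h4).symm
  obtain ⟨s, hs⟩ := h2
  have hdiv := Nat.mod_add_div (res2 p (-α)) p
  rw [hmod] at hdiv
  refine ⟨res p (-α), res2 p (-α) / p, s, ha, ?_, ?_⟩
  · have hd : (res2 p (-α) : ℤ_[p]) = res p (-α) + p * (res2 p (-α) / p : ℕ) := by
      rw [← Nat.cast_mul, ← Nat.cast_add, hdiv]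
    rw [hd] at hs
    linear_combination -hs
  · have hd : (res2 p (-α) : ℤ) = res p (-α) + p * (res2 p (-α) / p : ℕ) := by
      rw [← Nat.cast_mul, ← Nat.cast_add, hdiv]
    rw [lam2, hd, show (res p (-α) : ℤ) - (res p (-α) + p * (res2 p (-α) / p : ℕ)) =
      p * -((res2 p (-α) / p : ℕ) : ℤ) by ring,
      Int.mul_ediv_cancel_left _ (by exact_mod_cast hp.out.ne_zero)]
    push_cast [Nat.cast_sub hp.out.one_le]
    ring

theorem coe_ascPochhammer_eval (p : ℕ) [Fact p.Prime] (x : ℤ_[p]) (k : ℕ) :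
    (((ascPochhammer ℤ_[p] k).eval x : ℤ_[p]) : ℚ_[p]) = poch p (x : ℚ_[p]) k := by
  change PadicInt.Coe.ringHom _ = _
  rw [poch, ← ascPochhammer_map PadicInt.Coe.ringHom, Polynomial.eval_map]
  exact (Polynomial.eval₂_at_apply _ _).symm

/-- p-adic analogue of the Pfaff transformation
`₂F₁[α,α;1|z] = (1−z)^{−α} ₂F₁[α,1−α;1|z/(z−1)]` mod `p²`. -/
theorem padic_pfaff
    (p : ℕ) [Fact p.Prime] (hp : Odd p) (α z : ℤ_[p])
    (hz : IsUnit z) (hz1 : IsUnit (z - 1)) :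
    ‖(∑ k ∈ Finset.range p,
        poch p (α : ℚ_[p]) k ^ 2 / (Nat.factorial k : ℚ_[p]) ^ 2 * (z : ℚ_[p]) ^ k)
      - (z : ℚ_[p]) ^ (1 - lam2 p α) *
          ∑ k ∈ Finset.range p,
            poch p (α : ℚ_[p]) k ^ 2 / (Nat.factorial k : ℚ_[p]) ^ 2 * (z : ℚ_[p]) ^ (-(k : ℤ))
      - (1 - (z : ℚ_[p])) ^ (1 - lam2 p α) *
          ∑ k ∈ Finset.range p,
            poch p (α : ℚ_[p]) k * poch p (1 - (α : ℚ_[p])) k / (Nat.factorial k : ℚ_[p]) ^ 2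
              * ((z : ℚ_[p]) / ((z : ℚ_[p]) - 1)) ^ k‖
      ≤ (p : ℝ) ^ (-2 : ℤ) := by
  obtain ⟨a, t, s, ha, hα, hlam⟩ := exists_lam2_eq p α
  have hz1' : IsUnit (1 - z) := by rw [← neg_sub]; exact hz1.neg
  obtain ⟨w, hw⟩ := hz.exists_right_inv
  obtain ⟨y, hy⟩ := hz1'.exists_right_inv
  have hc : ∃ c : ℕ → ℤ_[p], ∀ k < p, c k * k.factorial = 1 := by
    have : ∀ k, ∃ c : ℤ_[p], k < p → c * k.factorial = 1 := fun k => by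
      by_cases hk : k < p
      · obtain ⟨c, hc⟩ := PadicInt.exists_mul_factorial_eq_one hk
        exact ⟨c, fun _ => hc⟩
      · exact ⟨0, fun h => absurd h hk⟩
    choose c hc using this
    exact ⟨c, hc⟩
  obtain ⟨c, hc⟩ := hc
  have key := pfaff_sq_dvd hw hy ha hc (PadicInt.natCast_dvd_pow_sub_one hz)
    (PadicInt.natCast_dvd_pow_sub_one hz1') hα
  rw [← Ideal.mem_span_singleton, ← PadicInt.norm_le_pow_iff_mem_span_pow,
    ← PadicInt.padic_norm_e_of_padicInt] at key
  refine le_trans (le_of_eq (congrArg norm ?_)) key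
  have hwQ : (w : ℚ_[p]) = (z : ℚ_[p])⁻¹ :=
    eq_inv_of_mul_eq_one_right (by exact_mod_cast congrArg ((↑) : ℤ_[p] → ℚ_[p]) hw)
  have hyQ : (y : ℚ_[p]) = (1 - (z : ℚ_[p]))⁻¹ :=
    eq_inv_of_mul_eq_one_right (by exact_mod_cast congrArg ((↑) : ℤ_[p] → ℚ_[p]) hy)
  have hcQ (k : ℕ) (hk : k ∈ Finset.range p) : (c k : ℚ_[p]) = (k.factorial : ℚ_[p])⁻¹ :=
    eq_inv_of_mul_eq_one_left
      (by exact_mod_cast congrArg ((↑) : ℤ_[p] → ℚ_[p]) (hc k (Finset.mem_range.mp hk)))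
  have hzy : (z : ℚ_[p]) / ((z : ℚ_[p]) - 1) = -(z * (1 - (z : ℚ_[p]))⁻¹) := by
    rw [← neg_sub (1 : ℚ_[p]), div_neg, div_eq_mul_inv]
  rw [hlam, zpow_natCast, zpow_natCast, hzy]
  push_cast [coe_ascPochhammer_eval, PadicInt.coe_sum]
  rw [hyQ, hwQ]
  congr! 2
  · refine Finset.sum_congr rfl fun k hk => ?_
    rw [hcQ k hk]
    ring
  · congr 1
    refine Finset.sum_congr rfl fun k hk => ?_
    rw [hcQ k hk, zpow_neg, zpow_natCast, inv_pow]
    ring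
  · refine Finset.sum_congr rfl fun k hk => ?_
    rw [hcQ k hk]
    ring
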